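/- Let n ≥ 2 be an integer, set m = (n−3)/2, and let c > 1 be real. Then there exist a constant C > 0 and z₀ ∈ (0, m+1) such that for every z ∈ (z₀, m+1), one has M(m+1−z, 2m+2; c·log((m+1)/(m+1−z))) ≥ C·(m+1−z)^{1−√c}. -/

import Mathlib

/-- The rising factorial (Pochhammer symbol) `(a)_k = a (a+1) ⋯ (a+k-1)`, with `(a)_0 = 1`. -/
noncomputable def risingFactorial (a : ℝ) (k : ℕ) : ℝ :=
  ∏ i ∈ Finset.range k, (a + i)

/-- The confluent hypergeometric function of the first kind,
`M(a,b;ρ) = ∑_{k=0}^∞ ((a)_k/(b)_k) ρ^k/k!`. -/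
noncomputable def CHF_M (a b ρ : ℝ) : ℝ :=
  ∑' k : ℕ, risingFactorial a k / risingFactorial b k * ρ ^ k / (Nat.factorial k : ℝ)

theorem risingFactorial_succ (a : ℝ) (k : ℕ) :
    risingFactorial a (k + 1) = risingFactorial a k * (a + k) :=
  Finset.prod_range_succ _ _

theorem risingFactorial_succ_left (a : ℝ) (k : ℕ) :
    risingFactorial a (k + 1) = a * risingFactorial (a + 1) k := by
  simp only [risingFactorial, Finset.prod_range_succ']
  push_cast
  rw [mul_comm, add_zero]
  congr 1
  exact Finset.prod_congr rfl fun i _ => by ring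

theorem risingFactorial_pos {a : ℝ} (ha : 0 < a) (k : ℕ) : 0 < risingFactorial a k :=
  Finset.prod_pos fun i _ => by positivity

theorem risingFactorial_mono {a b : ℝ} (ha : 0 ≤ a) (hab : a ≤ b) (k : ℕ) :
    risingFactorial a k ≤ risingFactorial b k :=
  Finset.prod_le_prod (fun i _ => by positivity) fun i _ => by linarith

theorem risingFactorial_one (k : ℕ) : risingFactorial 1 k = k.factorial := by
  induction k with
  | zero => simp [risingFactorial]
  | succ k ih => rw [risingFactorial_succ, ih, Nat.factorial_succ]; push_cast; ring

/-- A rising factorial outgrows `k!` by less than any exponential factor. -/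
theorem exists_mul_pow_mul_risingFactorial_le_factorial {b s : ℝ} (hb : 0 < b) (hs : 0 < s)
    (hs1 : s < 1) : ∃ C : ℝ, 0 < C ∧ ∀ k : ℕ, C * (s ^ k * risingFactorial b k) ≤ k.factorial := by
  set f : ℕ → ℝ := fun k => s ^ k * risingFactorial b k / k.factorial with hf
  have hf_pos : ∀ k, 0 < f k := fun k => by
    have := risingFactorial_pos hb k
    positivity
  obtain ⟨K, hK⟩ := exists_nat_ge (s * b / (1 - s))
  have hratio : ∀ k, K ≤ k → f (k + 1) ≤ f k := fun k hk => by
    have hKk : (K : ℝ) ≤ k := by exact_mod_cast hk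
    have h : s * (b + k) ≤ k + 1 := by
      rw [div_le_iff₀ (by linarith)] at hK
      nlinarith
    have hstep : f (k + 1) = f k * (s * (b + k) / (k + 1)) := by
      simp only [hf, risingFactorial_succ, Nat.factorial_succ, pow_succ]
      push_cast
      field_simp
    rw [hstep]
    exact mul_le_of_le_one_right (hf_pos k).le ((div_le_one (by positivity)).2 h)
  set B := ∑ i ∈ Finset.range (K + 1), f i
  have hle_sum : ∀ k, k ≤ K → f k ≤ B := fun k hk =>
    Finset.single_le_sum (fun i _ => (hf_pos i).le) (Finset.mem_range.2 (by omega))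
  have hbound : ∀ k, f k ≤ B := fun k => by
    rcases le_total k K with hk | hk
    · exact hle_sum k hk
    · induction k, hk using Nat.le_induction with
      | base => exact hle_sum K le_rfl
      | succ k hk ih => exact (hratio k hk).trans ih
  have hB_pos : 0 < B := (hf_pos 0).trans_le (hbound 0)
  refine ⟨B⁻¹, inv_pos.2 hB_pos, fun k => ?_⟩
  rw [inv_mul_le_iff₀ hB_pos]
  exact (div_le_iff₀ (by positivity)).1 (hbound k)

theorem exists_mul_pow_le_risingFactorial_div {b s : ℝ} (hb : 0 < b) (hs : 0 < s) (hs1 : s < 1) :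
    ∃ C : ℝ, 0 < C ∧ ∀ a : ℝ, 0 < a → a ≤ 1 → ∀ k : ℕ,
      C * a * s ^ k ≤ risingFactorial a k / risingFactorial b k := by
  obtain ⟨D, hD, h⟩ :=
    exists_mul_pow_mul_risingFactorial_le_factorial (b := b + 1) (by linarith) hs hs1
  refine ⟨min 1 (D / (s * b)), by positivity, fun a ha ha1 k => ?_⟩
  rcases k with _ | k
  · simp only [risingFactorial, Finset.range_zero, Finset.prod_empty, pow_zero, mul_one, div_one]
    exact mul_le_one₀ (min_le_left _ _) ha.le ha1
  · rw [le_div_iff₀ (risingFactorial_pos hb _), risingFactorial_succ_left,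
      risingFactorial_succ_left]
    have hR := risingFactorial_pos (a := b + 1) (by linarith) k
    calc min 1 (D / (s * b)) * a * s ^ (k + 1) * (b * risingFactorial (b + 1) k)
        ≤ D / (s * b) * a * s ^ (k + 1) * (b * risingFactorial (b + 1) k) := by
          gcongr
          exact min_le_right _ _
      _ = a * (D * (s ^ k * risingFactorial (b + 1) k)) := by
          rw [pow_succ]
          field_simp
      _ ≤ a * risingFactorial (a + 1) k := by
          refine mul_le_mul_of_nonneg_left ((h k).trans ?_) ha.le
          rw [← risingFactorial_one]
          exact risingFactorial_mono zero_le_one (by linarith) k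

theorem summable_CHF_M {a b ρ : ℝ} (ha : 0 < a) (hab : a ≤ b) (hρ : 0 ≤ ρ) :
    Summable fun k : ℕ =>
      risingFactorial a k / risingFactorial b k * ρ ^ k / (Nat.factorial k : ℝ) := by
  refine Summable.of_nonneg_of_le (fun k => ?_) (fun k => ?_) (Real.summable_pow_div_factorial ρ)
  · have := risingFactorial_pos ha k
    have := risingFactorial_pos (ha.trans_le hab) k
    positivity
  · gcongr
    refine mul_le_of_le_one_left (by positivity) ?_
    exact (div_le_one (risingFactorial_pos (ha.trans_le hab) k)).2
      (risingFactorial_mono ha.le hab k)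

/-- For `s < 1`, `M(a,b;ρ)` dominates `a e^{sρ}` uniformly in small `a` and `ρ ≥ 0`. -/
theorem exists_mul_exp_le_CHF_M {b s : ℝ} (hb : 0 < b) (hs : 0 < s) (hs1 : s < 1) :
    ∃ C : ℝ, 0 < C ∧ ∀ a ρ : ℝ, 0 < a → a ≤ 1 → a ≤ b → 0 ≤ ρ →
      C * a * Real.exp (s * ρ) ≤ CHF_M a b ρ := by
  obtain ⟨C, hC, h⟩ := exists_mul_pow_le_risingFactorial_div hb hs hs1
  refine ⟨C, hC, fun a ρ ha ha1 hab hρ => ?_⟩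
  rw [Real.exp_eq_exp_ℝ, NormedSpace.exp_eq_tsum_div, ← tsum_mul_left, CHF_M]
  refine Summable.tsum_le_tsum (fun k => ?_)
    ((Real.summable_pow_div_factorial (s * ρ)).mul_left _) (summable_CHF_M ha hab hρ)
  rw [mul_pow, ← mul_div_assoc, ← mul_assoc]
  gcongr
  exact h a ha ha1 k

/-- Let `n ≥ 2`, `m = (n−3)/2`, `c > 1`.  Then there are `C > 0` and `z₀ ∈ (0, m+1)` such
that for every `z ∈ (z₀, m+1)`:
`M(m+1−z, 2m+2; c log((m+1)/(m+1−z))) ≥ C (m+1−z)^{1−√c}`. -/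
theorem chf_algebraic_blowup (n : ℕ) (hn : 2 ≤ n) (m : ℝ) (hm : m = ((n : ℝ) - 3) / 2)
    (c : ℝ) (hc : 1 < c) :
    ∃ C : ℝ, 0 < C ∧ ∃ z₀ ∈ Set.Ioo (0 : ℝ) (m + 1), ∀ z ∈ Set.Ioo z₀ (m + 1),
      CHF_M (m + 1 - z) (2 * m + 2) (c * Real.log ((m + 1) / (m + 1 - z)))
        ≥ C * (m + 1 - z) ^ (1 - Real.sqrt c) := by
  have hn' : (2 : ℝ) ≤ n := by exact_mod_cast hn
  have hm1 : 0 < m + 1 := by linarith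
  have hsqrt : 1 < Real.sqrt c := Real.lt_sqrt_of_sq_lt (by linarith)
  obtain ⟨C, hC, h⟩ := exists_mul_exp_le_CHF_M (b := 2 * m + 2) (s := (Real.sqrt c)⁻¹)
    (by linarith) (by positivity) (inv_lt_one_of_one_lt₀ hsqrt)
  refine ⟨C * (m + 1) ^ Real.sqrt c, by positivity, max ((m + 1) / 2) m,
    ⟨lt_max_of_lt_left (by linarith), max_lt (by linarith) (by linarith)⟩, fun z hz => ?_⟩
  have hz1 := (le_max_left _ _).trans_lt hz.1
  have hz2 := (le_max_right _ _).trans_lt hz.1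
  have hz3 := hz.2
  have ha : 0 < m + 1 - z := by linarith
  have hlog : 0 ≤ Real.log ((m + 1) / (m + 1 - z)) :=
    Real.log_nonneg ((one_le_div ha).2 (by linarith))
  refine le_of_eq_of_le ?_ (h (m + 1 - z) (c * Real.log ((m + 1) / (m + 1 - z))) ha
    (by linarith) (by linarith) (by positivity))
  have hsc : (Real.sqrt c)⁻¹ * c = Real.sqrt c := by
    rw [inv_mul_eq_div, Real.div_sqrt]
  rw [← mul_assoc, hsc, mul_comm (Real.sqrt c), ← Real.rpow_def_of_pos (by positivity),
    Real.div_rpow hm1.le ha.le, Real.rpow_sub ha, Real.rpow_one]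
  ring
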